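/- Let X be a finite nonempty set with n = |X|, let DP_X denote the set of all discrete pseudometrics on X, and let ≈ denote the equivalence relation of combinatorial similarity on DP_X. Then the cardinality of the quotient set DP_X/≈ equals the number of distinct representations of n as a sum of positive integers, i.e., the number of partitions of the integer n. -/

import Mathlib

open Set

universe u v w z

def range2 {X : Type u} {A : Type w} (Φ : X → X → A) : Set A := {a | ∃ x y, Φ x y = a}

def fiber {X : Type u} {A : Type w} (Φ : X → X → A) (a : A) : Set (X × X) :=
  {p | Φ p.1 p.2 = a}

def fibers {X : Type u} {A : Type w} (Φ : X → X → A) : Set (Set (X × X)) :=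
  {R | ∃ a ∈ range2 Φ, R = fiber Φ a}

def IsCoherent {X : Type u} {A : Type w} (Φ : X → X → A) (a₀ : A) : Prop :=
  Equivalence (fun x y => Φ x y = a₀) ∧
    ∀ x₁ x₂ x₃ x₄, Φ x₁ x₂ = a₀ → Φ x₃ x₄ = a₀ → Φ x₁ x₃ = Φ x₂ x₄

def CombSim {X : Type u} {Y : Type v} {A : Type w} {B : Type z}
    (Φ : X → X → A) (Ψ : Y → Y → B) : Prop :=
  ∃ (g : Y → X) (f : A → B), Function.Bijective g ∧
    Set.BijOn f (range2 Φ) (range2 Ψ) ∧ ∀ x y, Ψ x y = f (Φ (g x) (g y))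

def IsPseudometric {X : Type u} (d : X → X → ℝ) : Prop :=
  (∀ x y, 0 ≤ d x y) ∧ (∀ x y, d x y = d y x) ∧ (∀ x, d x x = 0) ∧
    ∀ x y z, d x y ≤ d x z + d z y

def IsDiscretePseudometric {X : Type u} (d : X → X → ℝ) : Prop :=
  IsPseudometric d ∧ Cardinal.mk (range2 d) ≤ 2

section FiberCards

variable {α β X Y : Type*} [Fintype α] [Fintype β]

open scoped Classical in
theorem exists_equiv_of_map_univ_eq {γ : Type*} {f : α → γ} {g : β → γ}
    (h : Finset.univ.val.map f = Finset.univ.val.map g) : ∃ e : α ≃ β, ∀ a, g (e a) = f a := by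
  have key (c : γ) : Fintype.card {a // f a = c} = Fintype.card {b // g b = c} := by
    have := congrArg (Multiset.count c) h
    simpa [Multiset.count_map, Fintype.card_subtype, Finset.card_def, eq_comm] using this
  exact ⟨Equiv.ofFiberEquiv fun c => Fintype.equivOfCardEq (key c),
    Equiv.ofFiberEquiv_map _⟩

/-- The multiset of cardinalities of the fibers of a map between finite types. -/
noncomputable def fiberCards (π : X → α) : Multiset ℕ :=
  Finset.univ.val.map fun a => Nat.card {x // π x = a}

theorem sum_fiberCards [Fintype X] (π : X → α) : (fiberCards π).sum = Fintype.card X := by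
  rw [← Nat.card_eq_fintype_card, ← Nat.card_congr (Equiv.sigmaFiberEquiv π), Nat.card_sigma]
  rfl

theorem pos_of_mem_fiberCards [Finite X] {π : X → α} (hπ : Function.Surjective π) {k : ℕ}
    (hk : k ∈ fiberCards π) : 0 < k := by
  obtain ⟨a, -, rfl⟩ := Multiset.mem_map.1 hk
  obtain ⟨x, hx⟩ := hπ a
  have : Nonempty {x // π x = a} := ⟨⟨x, hx⟩⟩
  exact Nat.card_pos

theorem fiberCards_congr {π : X → α} {ρ : Y → β} (e : X ≃ Y) (f : α ≃ β)
    (h : ∀ x, ρ (e x) = f (π x)) : fiberCards π = fiberCards ρ := by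
  rw [fiberCards, fiberCards, ← Multiset.map_univ_val_equiv f, Multiset.map_map]
  refine Multiset.map_congr rfl fun a _ => Nat.card_congr (e.subtypeEquiv fun x => ?_)
  rw [h, f.apply_eq_iff_eq]

open scoped Classical in
theorem fiberCards_quotient_congr [Fintype X] [Fintype Y] {r : Setoid X} {s : Setoid Y} (e : X ≃ Y)
    (h : ∀ x y, r x y ↔ s (e x) (e y)) :
    fiberCards (Quotient.mk r) = fiberCards (Quotient.mk s) :=
  fiberCards_congr e (Quotient.congr e h) fun _ => rfl

theorem exists_perm_of_fiberCards_eq [Finite X] {π : X → α} {ρ : X → β}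
    (h : fiberCards π = fiberCards ρ) :
    ∃ e : Equiv.Perm X, ∀ x y, π x = π y ↔ ρ (e x) = ρ (e y) := by
  obtain ⟨f, hf⟩ := exists_equiv_of_map_univ_eq h
  have g (c : β) : Nonempty ({x // f (π x) = c} ≃ {x // ρ x = c}) := by
    refine Finite.card_eq.1 ?_
    obtain ⟨a, rfl⟩ := f.surjective c
    simpa only [f.apply_eq_iff_eq] using (hf a).symm
  refine ⟨Equiv.ofFiberEquiv fun c => (g c).some, fun x y => ?_⟩
  simp only [Equiv.ofFiberEquiv_map, f.apply_eq_iff_eq]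

theorem exists_surjective_fiberCards [Fintype X] {n : ℕ} (p : n.Partition) (hn : n = Fintype.card X) :
    ∃ π : X → p.parts, Function.Surjective π ∧ fiberCards π = p.parts := by
  have hcard : Fintype.card X = Fintype.card (Σ i : p.parts, Fin i) := by
    rw [← hn, Fintype.card_sigma]
    simp only [Fintype.card_fin]
    rw [← Multiset.sum_eq_sum_coe, p.parts_sum]
  let e := Fintype.equivOfCardEq hcard
  refine ⟨fun x => (e x).1, fun i => ?_, ?_⟩
  · exact ⟨e.symm ⟨i, 0, p.parts_pos Multiset.coe_mem⟩, by simp⟩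
  · conv_rhs => rw [← Multiset.map_univ_coe p.parts]
    refine Multiset.map_congr rfl fun i _ => ?_
    rw [Nat.card_congr ((e.subtypeEquiv (q := fun z => z.1 = i) fun x => Iff.rfl).trans
      (Equiv.sigmaSubtype i))]
    simp

end FiberCards

section Pseudometric

variable {X : Type u} {d d₁ d₂ : X → X → ℝ}

/-- The equivalence relation of being at distance zero. -/
def IsPseudometric.zeroSetoid (h : IsPseudometric d) : Setoid X where
  r x y := d x y = 0
  iseqv := ⟨h.2.2.1, fun {x y} hxy => (h.2.1 y x).trans hxy, fun {x y z} hxy hyz =>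
    le_antisymm ((h.2.2.2 x z y).trans (by rw [hxy, hyz, add_zero])) (h.1 x z)⟩

open scoped Classical in
/-- The partition of the cardinality of `X` into the sizes of the zero-distance classes. -/
noncomputable def IsPseudometric.zeroPartition [Fintype X] (h : IsPseudometric d) {n : ℕ}
    (hn : n = Fintype.card X) : n.Partition where
  parts := fiberCards (Quotient.mk h.zeroSetoid)
  parts_pos := pos_of_mem_fiberCards Quotient.mk_surjective
  parts_sum := (sum_fiberCards _).trans hn.symm

theorem CombSim.exists_perm_eq_zero_iff [Nonempty X] (h : CombSim d₁ d₂)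
    (h₁ : IsPseudometric d₁) (h₂ : IsPseudometric d₂) :
    ∃ e : Equiv.Perm X, ∀ x y, d₁ x y = 0 ↔ d₂ (e x) (e y) = 0 := by
  obtain ⟨g, f, hg, hf, hfg⟩ := h
  have hf0 : f 0 = 0 := by
    obtain ⟨x⟩ := ‹Nonempty X›
    rw [← h₁.2.2.1 (g x), ← hfg, h₂.2.2.1]
    exact (h₁.2.2.1 _).symm
  refine ⟨(Equiv.ofBijective g hg).symm, fun x y => ?_⟩
  have hgs : ∀ x, g ((Equiv.ofBijective g hg).symm x) = x :=
    (Equiv.ofBijective g hg).apply_symm_apply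
  rw [hfg, hgs, hgs]
  refine ⟨fun h => by rw [h, hf0], fun h => hf.injOn ⟨x, y, rfl⟩ ⟨x, x, h₁.2.2.1 x⟩ ?_⟩
  rw [h, hf0]

theorem IsDiscretePseudometric.eq_of_ne_zero (h : IsDiscretePseudometric d) {a b : ℝ}
    (ha : a ∈ range2 d) (hb : b ∈ range2 d) (ha0 : a ≠ 0) (hb0 : b ≠ 0) : a = b := by
  by_contra hab
  have h0 : (0 : ℝ) ∈ range2 d := by
    obtain ⟨x, -, -⟩ := ha
    exact ⟨x, x, h.1.2.2.1 x⟩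
  have hsub : ({0, a, b} : Set ℝ) ⊆ range2 d := by
    rintro c (rfl | rfl | rfl) <;> assumption
  have h3 : ({0, a, b} : Set ℝ).encard = 3 :=
    Set.encard_eq_three.2 ⟨0, a, b, ha0.symm, hb0.symm, hab, rfl⟩
  have h2 : (range2 d).encard ≤ 2 := by
    simpa using Cardinal.toENat.monotone' h.2
  have := h3 ▸ (Set.encard_le_encard hsub).trans h2
  exact absurd this (by decide)

theorem IsDiscretePseudometric.exists_range2_subset (h : IsDiscretePseudometric d) :
    ∃ t ≠ 0, ∀ x y, d x y = 0 ∨ d x y = t := by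
  by_cases hd : ∃ t ∈ range2 d, t ≠ 0
  · obtain ⟨t, ht, ht0⟩ := hd
    exact ⟨t, ht0, fun x y => or_iff_not_imp_left.2 fun hxy =>
      h.eq_of_ne_zero ⟨x, y, rfl⟩ ht hxy ht0⟩
  · push Not at hd
    exact ⟨1, one_ne_zero, fun x y => .inl (hd _ ⟨x, y, rfl⟩)⟩

theorem IsDiscretePseudometric.combSim (h₁ : IsDiscretePseudometric d₁)
    (h₂ : IsDiscretePseudometric d₂) (e : Equiv.Perm X)
    (he : ∀ x y, d₂ x y = 0 ↔ d₁ (e x) (e y) = 0) : CombSim d₁ d₂ := by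
  classical
  obtain ⟨t, ht, hd⟩ := h₂.exists_range2_subset
  have key x y : d₂ x y = if d₁ (e x) (e y) = 0 then 0 else t := by
    split_ifs with h
    · exact (he x y).2 h
    · exact (hd x y).resolve_left (mt (he x y).1 h)
  refine ⟨e, fun a => if a = 0 then 0 else t, e.bijective, ⟨?_, ?_, ?_⟩, key⟩
  · rintro _ ⟨x, y, rfl⟩
    exact ⟨e.symm x, e.symm y, by simp [key]⟩
  · intro a ha b hb hab
    by_cases ha0 : a = 0 <;> by_cases hb0 : b = 0
    · rw [ha0, hb0]
    · simp [ha0, hb0, ht.symm] at hab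
    · simp [ha0, hb0, ht] at hab
    · exact h₁.eq_of_ne_zero ha hb ha0 hb0
  · rintro _ ⟨x, y, rfl⟩
    exact ⟨d₁ (e x) (e y), ⟨_, _, rfl⟩, (key x y).symm⟩

open scoped Classical in
theorem isDiscretePseudometric_indicator {ι : Type*} (π : X → ι) :
    IsDiscretePseudometric fun x y => if π x = π y then (0 : ℝ) else 1 := by
  refine ⟨⟨fun x y => ?_, fun x y => ?_, fun x => if_pos rfl, fun x y z => ?_⟩, ?_⟩
  · positivity
  · simp only [eq_comm]
  · dsimp only
    grind
  · refine (Cardinal.mk_le_mk_of_subset (t := {0, 1}) ?_).trans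
      (Cardinal.mk_insert_le.trans (by simp [one_add_one_eq_two]))
    rintro _ ⟨x, y, rfl⟩
    dsimp only
    split_ifs <;> simp

end Pseudometric

/-- Proposition 3.8: for a finite nonempty set `X` with `n = |X|`, the number of classes
of discrete pseudometrics on `X` up to combinatorial similarity equals the number of
partitions of the integer `n`. -/
theorem card_discrete_pseudometrics_up_to_combSim {X : Type u} [Fintype X] [Nonempty X]
    (n : ℕ) (hn : n = Fintype.card X) :
    Nat.card
        (Quot (fun d₁ d₂ : {d : X → X → ℝ // IsDiscretePseudometric d} =>
          CombSim d₁.1 d₂.1)) =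
      Fintype.card (Nat.Partition n) := by
  classical
  rw [← Nat.card_eq_fintype_card]
  let F : Quot (fun d₁ d₂ : {d : X → X → ℝ // IsDiscretePseudometric d} =>
      CombSim d₁.1 d₂.1) → Nat.Partition n :=
    Quot.lift (fun d => d.2.1.zeroPartition hn) fun d₁ d₂ h => by
      obtain ⟨e, he⟩ := h.exists_perm_eq_zero_iff d₁.2.1 d₂.2.1
      refine Nat.Partition.ext (fiberCards_quotient_congr e fun x y => ?_)
      exact he x y
  refine Nat.card_congr (Equiv.ofBijective F ⟨?_, fun p => ?_⟩)
  · rintro ⟨d₁⟩ ⟨d₂⟩ h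
    obtain ⟨e, he⟩ := exists_perm_of_fiberCards_eq (congrArg Nat.Partition.parts h)
    refine Quot.sound (d₁.2.combSim d₂.2 e.symm fun x y => ?_)
    have := he (e.symm x) (e.symm y)
    simpa [Quotient.eq, IsPseudometric.zeroSetoid] using this.symm
  · obtain ⟨π, hπ, hcard⟩ := exists_surjective_fiberCards (X := X) p hn
    refine ⟨Quot.mk _ ⟨_, isDiscretePseudometric_indicator π⟩, Nat.Partition.ext ?_⟩
    refine Eq.trans ?_ hcard
    let r := (isDiscretePseudometric_indicator π).1.zeroSetoid
    refine fiberCards_congr (Equiv.refl X) (Equiv.ofBijective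
      (Quotient.lift π fun x y h => by
        have h' : (if π x = π y then (0 : ℝ) else 1) = 0 := h
        simpa using h')
      ⟨?_, fun i => ?_⟩) fun x => rfl
    · rintro ⟨x⟩ ⟨y⟩ h
      refine Quotient.sound ?_
      have h' : π x = π y := h
      change (if π x = π y then (0 : ℝ) else 1) = 0
      simp [h']
    · obtain ⟨x, rfl⟩ := hπ i
      exact ⟨⟦x⟧, rfl⟩
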